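/- Let Q be a finite nonempty set of points in EuclideanSpace ℝ (Fin d) with centroid μ(Q), let m ≥ 1 be a natural number and ε > 0 a real. Then the number of functions s : Fin m → Q such that cost(Q, (1/m)·Σ_{i} s(i)) > (1 + ε)·cost(Q, μ(Q)) is at most |Q|^m / (ε·m). -/

import Mathlib

open Finset

/-- `cost Q c = ∑_{q ∈ Q} ‖q - c‖²` -/
noncomputable def cost {d : ℕ} (Q : Finset (EuclideanSpace ℝ (Fin d)))
    (c : EuclideanSpace ℝ (Fin d)) : ℝ := ∑ q ∈ Q, ‖q - c‖ ^ 2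

/-- `mu Q` is the centroid (mean) of the finite set `Q`. -/
noncomputable def mu {d : ℕ} (Q : Finset (EuclideanSpace ℝ (Fin d))) :
    EuclideanSpace ℝ (Fin d) := (Q.card : ℝ)⁻¹ • ∑ q ∈ Q, q

/-- If `f` sums to zero, the second moment of the sum of `m` independent uniform samples of `f`
is `m` times the second moment of `f`. -/
theorem card_mul_sum_norm_sum_sq {α E : Type*} [Fintype α] [NormedAddCommGroup E]
    [InnerProductSpace ℝ E] (f : α → E) (hf : ∑ a, f a = 0) (m : ℕ) :
    (Fintype.card α : ℝ) * ∑ s : Fin m → α, ‖∑ i, f (s i)‖ ^ 2 =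
      m * (Fintype.card α : ℝ) ^ m * ∑ a, ‖f a‖ ^ 2 := by
  induction m with
  | zero => simp
  | succ m ih =>
    have hsplit : ∑ s : Fin (m + 1) → α, ‖∑ i, f (s i)‖ ^ 2 =
        (Fintype.card α : ℝ) ^ m * ∑ a, ‖f a‖ ^ 2 +
          (Fintype.card α : ℝ) * ∑ s : Fin m → α, ‖∑ i, f (s i)‖ ^ 2 := by
      rw [← (Fin.consEquiv fun _ : Fin (m + 1) => α).sum_comp, Fintype.sum_prod_type_right]
      have hfiber (s : Fin m → α) : ∑ a, ‖f a + ∑ i, f (s i)‖ ^ 2 =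
          ∑ a, ‖f a‖ ^ 2 + (Fintype.card α : ℝ) * ‖∑ i, f (s i)‖ ^ 2 := by
        simp_rw [norm_add_sq_real]
        rw [sum_add_distrib, sum_add_distrib, ← mul_sum, ← sum_inner, hf]
        simp
      simp [Fin.consEquiv, Fin.sum_univ_succ, hfiber, sum_add_distrib, mul_sum]
    rw [hsplit, mul_add, ih]
    push_cast
    ring

theorem sum_sub_mu {d : ℕ} {Q : Finset (EuclideanSpace ℝ (Fin d))} (hQ : Q.Nonempty) :
    ∑ q ∈ Q, (q - mu Q) = 0 := by
  have h : (Q.card : ℝ) ≠ 0 := by exact_mod_cast hQ.card_pos.ne'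
  rw [sum_sub_distrib, sum_const, ← Nat.cast_smul_eq_nsmul ℝ, mu, smul_inv_smul₀ h, sub_self]

theorem cost_eq_cost_mu_add {d : ℕ} {Q : Finset (EuclideanSpace ℝ (Fin d))} (hQ : Q.Nonempty)
    (c : EuclideanSpace ℝ (Fin d)) :
    cost Q c = cost Q (mu Q) + Q.card * ‖c - mu Q‖ ^ 2 := by
  have h (q : EuclideanSpace ℝ (Fin d)) : ‖q - c‖ ^ 2 =
      ‖q - mu Q‖ ^ 2 - 2 * inner ℝ (q - mu Q) (c - mu Q) + ‖c - mu Q‖ ^ 2 := by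
    rw [← norm_sub_sq_real, sub_sub_sub_cancel_right]
  simp_rw [cost, h]
  rw [sum_add_distrib, sum_sub_distrib, ← mul_sum, ← sum_inner, sum_sub_mu hQ]
  simp

/-- The total squared deviation of the means of all `m`-tuples of points of `Q`. -/
theorem card_mul_sum_norm_mean_sub_mu_sq {d m : ℕ} (hm : m ≠ 0)
    {Q : Finset (EuclideanSpace ℝ (Fin d))} (hQ : Q.Nonempty) :
    ∑ s : Fin m → Q, (Q.card : ℝ) *
        ‖(m : ℝ)⁻¹ • (∑ i, (s i : EuclideanSpace ℝ (Fin d))) - mu Q‖ ^ 2 =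
      (Q.card : ℝ) ^ m / m * cost Q (mu Q) := by
  have hm' : (m : ℝ) ≠ 0 := by exact_mod_cast hm
  have hmean (s : Fin m → Q) :
      ‖(m : ℝ)⁻¹ • (∑ i, (s i : EuclideanSpace ℝ (Fin d))) - mu Q‖ ^ 2 =
        ((m : ℝ) ^ 2)⁻¹ * ‖∑ i, ((s i : EuclideanSpace ℝ (Fin d)) - mu Q)‖ ^ 2 := by
    have h : (m : ℝ)⁻¹ • (∑ i, (s i : EuclideanSpace ℝ (Fin d))) - mu Q =
        (m : ℝ)⁻¹ • ∑ i, ((s i : EuclideanSpace ℝ (Fin d)) - mu Q) := by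
      rw [sum_sub_distrib, smul_sub, sum_const, card_univ, Fintype.card_fin,
        ← Nat.cast_smul_eq_nsmul ℝ, inv_smul_smul₀ hm']
    rw [h, norm_smul, mul_pow, norm_inv, Real.norm_natCast, inv_pow]
  have hsum : ∑ q : Q, ((q : EuclideanSpace ℝ (Fin d)) - mu Q) = 0 := by
    rw [sum_coe_sort Q (fun q => q - mu Q), sum_sub_mu hQ]
  have hmoment := card_mul_sum_norm_sum_sq _ hsum m
  rw [Fintype.card_coe, sum_coe_sort Q (fun q => ‖q - mu Q‖ ^ 2)] at hmoment
  simp_rw [hmean]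
  rw [← mul_sum, ← mul_sum, mul_left_comm, hmoment, cost]
  field_simp

/-- Weak coreset lemma for 1-means (counting form): the number of `m`-tuples of points of
`Q` whose sample mean fails to be a `(1+ε)`-approximate 1-means center of `Q` is at most
`|Q|^m / (ε·m)`. -/
theorem weak_coreset_for_one_mean {d m : ℕ} (hm : 1 ≤ m) (ε : ℝ) (hε : 0 < ε)
    (Q : Finset (EuclideanSpace ℝ (Fin d))) (hQ : Q.Nonempty) :
    (Nat.card {s : Fin m → Q //
        cost Q ((m : ℝ)⁻¹ • (∑ i, (s i : EuclideanSpace ℝ (Fin d)))) >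
          (1 + ε) * cost Q (mu Q)} : ℝ) ≤
      (Q.card : ℝ) ^ m / (ε * m) := by
  classical
  have hm' : (0 : ℝ) < m := by exact_mod_cast hm
  have hcost : 0 ≤ cost Q (mu Q) := sum_nonneg fun _ _ => by positivity
  set g : (Fin m → Q) → ℝ := fun s => (Q.card : ℝ) *
    ‖(m : ℝ)⁻¹ • (∑ i, (s i : EuclideanSpace ℝ (Fin d))) - mu Q‖ ^ 2
  have hg0 (s : Fin m → Q) : 0 ≤ g s := by positivity
  have htotal : ∑ s, g s = (Q.card : ℝ) ^ m / m * cost Q (mu Q) :=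
    card_mul_sum_norm_mean_sub_mu_sq (by omega) hQ
  have hbad (s : Fin m → Q) :
      cost Q ((m : ℝ)⁻¹ • (∑ i, (s i : EuclideanSpace ℝ (Fin d)))) > (1 + ε) * cost Q (mu Q) ↔
        ε * cost Q (mu Q) < g s := by
    rw [cost_eq_cost_mu_add hQ, gt_iff_lt, one_add_mul, add_lt_add_iff_left]
  simp_rw [hbad]
  rw [Nat.card_eq_fintype_card, Fintype.card_subtype]
  rcases hcost.eq_or_lt with h0 | hpos
  · rw [← h0, mul_zero, sum_eq_zero_iff_of_nonneg fun s _ => hg0 s] at htotal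
    rw [filter_false_of_mem fun s hs => by rw [htotal s hs, ← h0, mul_zero]; exact lt_irrefl 0]
    rw [card_empty, Nat.cast_zero]
    positivity
  · have hmarkov : (#{s | ε * cost Q (mu Q) < g s} : ℝ) * (ε * cost Q (mu Q)) ≤ ∑ s, g s := by
      rw [← nsmul_eq_mul]
      exact (card_nsmul_le_sum _ _ _ fun s hs => (mem_filter.1 hs).2.le).trans
        (sum_le_univ_sum_of_nonneg hg0)
    rw [htotal, ← mul_assoc] at hmarkov
    rw [mul_comm ε (m : ℝ), ← div_div, le_div_iff₀ hε]
    exact le_of_mul_le_mul_right hmarkov hpos
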